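/- arXiv:1704.03102 — 2 statements merged into one kernel-verified Lean document; each statement's English description precedes it below -/
import Mathlib

section
/- Let λ < 0 and C ≥ 0 be real constants, let τ > 0, and let g : ℝ → ℝ be a differentiable function such that g'(t) ≤ λ·g(t) − (C²·t²)/λ for all t ∈ [0,τ]. Then for all t ∈ [0,τ]: g(t) ≤ g(0)·e^{λt} + (C²/λ²)·( t² + 2t/λ + (2/λ²)·(1 − e^{λt}) ). -/
open Set

/-- Homogeneous scalar Grönwall inequality, with no sign condition on the rate or the function. -/
theorem le_mul_exp_of_deriv_le_mul {f f' : ℝ → ℝ} {k τ : ℝ}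
    (hf : ∀ t, HasDerivAt f (f' t) t) (hle : ∀ t ∈ Icc (0 : ℝ) τ, f' t ≤ k * f t) :
    ∀ t ∈ Icc (0 : ℝ) τ, f t ≤ f 0 * Real.exp (k * t) := by
  intro t ht
  have hd : ∀ s, HasDerivAt (fun s => f s * Real.exp (-(k * s)))
      ((f' s - k * f s) * Real.exp (-(k * s))) s := by
    intro s
    have hlin : HasDerivAt (fun s => -(k * s)) (-k) s := by
      simpa using ((hasDerivAt_id' s).const_mul k).fun_neg
    exact ((hf s).fun_mul hlin.exp).congr_deriv (by ring)
  have hanti : AntitoneOn (fun s => f s * Real.exp (-(k * s))) (Icc 0 τ) := by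
    refine antitoneOn_of_hasDerivWithinAt_nonpos (convex_Icc 0 τ)
      (fun s _ => (hd s).continuousAt.continuousWithinAt)
      (fun s _ => (hd s).hasDerivWithinAt) fun s hs => ?_
    exact mul_nonpos_of_nonpos_of_nonneg
      (sub_nonpos.2 (hle s (interior_subset hs))) (Real.exp_pos _).le
  have h := hanti ⟨le_rfl, ht.1.trans ht.2⟩ ht ht.1
  simp only [mul_zero, neg_zero, Real.exp_zero, mul_one, Real.exp_neg] at h
  rwa [← div_eq_mul_inv, div_le_iff₀ (Real.exp_pos _)] at h

theorem gronwall_neg_lambda (lam C τ : ℝ) (hlam : lam < 0) (hC : 0 ≤ C) (hτ : 0 < τ)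
    (g : ℝ → ℝ) (hg : Differentiable ℝ g)
    (hineq : ∀ t ∈ Icc (0 : ℝ) τ, deriv g t ≤ lam * g t - C ^ 2 * t ^ 2 / lam) :
    ∀ t ∈ Icc (0 : ℝ) τ,
      g t ≤ g 0 * Real.exp (lam * t) +
        (C ^ 2 / lam ^ 2) *
          (t ^ 2 + 2 * t / lam + (2 / lam ^ 2) * (1 - Real.exp (lam * t))) := by
  intro t ht
  have hne : lam ≠ 0 := hlam.ne
  -- Subtract the polynomial particular solution of the linear ODE.
  have hd : ∀ s, HasDerivAt
      (fun s => g s - C ^ 2 / lam ^ 2 * (s ^ 2 + 2 / lam * s + 2 / lam ^ 2))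
      (deriv g s - C ^ 2 / lam ^ 2 * (2 * s + 2 / lam)) s := by
    intro s
    refine (hg s).hasDerivAt.sub (HasDerivAt.const_mul _ (HasDerivAt.add_const _ ?_))
    simpa using (hasDerivAt_pow 2 s).fun_add ((hasDerivAt_id' s).const_mul (2 / lam))
  have h := le_mul_exp_of_deriv_le_mul (k := lam) (τ := τ) hd (fun s hs => by
    have hode : lam * (C ^ 2 / lam ^ 2 * (s ^ 2 + 2 / lam * s + 2 / lam ^ 2)) =
        C ^ 2 / lam ^ 2 * (2 * s + 2 / lam) + C ^ 2 * s ^ 2 / lam := by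
      field_simp
      ring
    linarith [hineq s hs]) t ht
  linear_combination h
end

section
/- Let S ⊆ ℝⁿ be a convex set (Euclidean norm), let τ > 0, let x : ℝ → ℝⁿ, let x̃⁰, v ∈ ℝⁿ with x̃(t) = x̃⁰ + t·v, and let Δ : ℝ → ℝ be a function with Δ(t) ≥ 0 for t ∈ [0,τ]. Assume: (i) ‖x(t) − x̃(t)‖ ≤ Δ(t) for all t ∈ [0,τ]; (ii) Δ is convex on [0,τ]; (iii) the closed ball B(x̃(0), Δ(0)) is contained in S; (iv) the closed ball B(x̃(τ), Δ(τ)) is contained in S. Then x(t) ∈ S for all t ∈ [0,τ]. -/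
open Set

/-- If a convex set contains two closed balls, it contains every convex combination of them. -/
theorem Convex.closedBall_combo_subset {E : Type*} [NormedAddCommGroup E] [NormedSpace ℝ E]
    {S : Set E} (hS : Convex ℝ S) {a b : E} {r s : ℝ} (hr : 0 ≤ r) (hs : 0 ≤ s)
    (ha : Metric.closedBall a r ⊆ S) (hb : Metric.closedBall b s ⊆ S)
    {p q : ℝ} (hp : 0 ≤ p) (hq : 0 ≤ q) (hpq : p + q = 1) :
    Metric.closedBall (p • a + q • b) (p * r + q * s) ⊆ S := by
  intro y hy
  rw [mem_closedBall_iff_norm] at hy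
  set R := p * r + q * s with hR
  set e := y - (p • a + q • b) with he
  set u := R⁻¹ • e with hu
  have hR0 : 0 ≤ R := by positivity
  have hRu : R • u = e := by
    rcases eq_or_ne R 0 with h | h
    · rw [h, norm_le_zero_iff] at hy
      simp [h, hy]
    · exact smul_inv_smul₀ h e
  have hu1 : ‖u‖ ≤ 1 := by
    rw [hu, norm_smul, norm_inv, Real.norm_of_nonneg hR0]
    exact inv_mul_le_one_of_le₀ hy hR0
  have mem_ball (c : E) {ρ : ℝ} (hρ : 0 ≤ ρ) : c + ρ • u ∈ Metric.closedBall c ρ := by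
    rw [mem_closedBall_iff_norm, add_sub_cancel_left, norm_smul, Real.norm_of_nonneg hρ]
    exact mul_le_of_le_one_right hρ hu1
  have hy_eq : y = p • (a + r • u) + q • (b + s • u) := by
    rw [← sub_add_cancel y (p • a + q • b), ← he, ← hRu, hR]
    module
  rw [hy_eq]
  exact hS (ha (mem_ball a hr)) (hb (mem_ball b hs)) hp hq hpq

theorem trajectory_in_convex_safe_set {n : ℕ}
    (S : Set (EuclideanSpace ℝ (Fin n))) (hS : Convex ℝ S)
    (τ : ℝ) (hτ : 0 < τ)
    (x : ℝ → EuclideanSpace ℝ (Fin n))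
    (x0tilde v : EuclideanSpace ℝ (Fin n))
    (xtilde : ℝ → EuclideanSpace ℝ (Fin n))
    (hxtilde : ∀ t : ℝ, xtilde t = x0tilde + t • v)
    (Δ : ℝ → ℝ) (hΔnonneg : ∀ t ∈ Icc (0 : ℝ) τ, 0 ≤ Δ t)
    (hbound : ∀ t ∈ Icc (0 : ℝ) τ, ‖x t - xtilde t‖ ≤ Δ t)
    (hconv : ConvexOn ℝ (Icc (0 : ℝ) τ) Δ)
    (h0 : Metric.closedBall (xtilde 0) (Δ 0) ⊆ S)
    (hτball : Metric.closedBall (xtilde τ) (Δ τ) ⊆ S) :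
    ∀ t ∈ Icc (0 : ℝ) τ, x t ∈ S := by
  intro t ht
  have hleft : (0 : ℝ) ∈ Icc 0 τ := left_mem_Icc.2 hτ.le
  have hright : τ ∈ Icc 0 τ := right_mem_Icc.2 hτ.le
  have hq : 0 ≤ t / τ := div_nonneg ht.1 hτ.le
  have hp : 0 ≤ 1 - t / τ := sub_nonneg.2 (div_le_one_of_le₀ ht.2 hτ.le)
  have hpq : 1 - t / τ + t / τ = 1 := sub_add_cancel 1 (t / τ)
  have hmul : t / τ * τ = t := div_mul_cancel₀ t hτ.ne'
  have hcenter : (1 - t / τ) • xtilde 0 + (t / τ) • xtilde τ = xtilde t := by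
    rw [hxtilde, hxtilde, hxtilde, smul_add (t / τ), smul_smul, hmul]
    module
  have hradius := hconv.2 hleft hright hp hq hpq
  simp only [smul_eq_mul, mul_zero, zero_add, hmul] at hradius
  apply hS.closedBall_combo_subset (hΔnonneg 0 hleft) (hΔnonneg τ hright) h0 hτball hp hq hpq
  rw [hcenter, mem_closedBall_iff_norm]
  exact (hbound t ht).trans hradius
end
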